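/- arXiv:1605.09345 — 2 statements merged into one kernel-verified Lean document; each statement's English description precedes it below -/
import Mathlib

section
/- Let α be an ordinal and let τ be a Hausdorff topology on the α-bicyclic monoid B_α for which multiplication is separately continuous. Then for every pair of distinct ordinals a, b < α, the element (ω^a, ω^b) is an isolated point of (B_α, τ). -/
open Ordinal

/-- The `α`-bicyclic monoid `B_α`: the set of pairs `(a, b)` of ordinals with
`a, b < ω ^ α`. -/
def Balpha (α : Ordinal) : Type _ :=
  {p : Ordinal × Ordinal // p.1 < omega0 ^ α ∧ p.2 < omega0 ^ α}

/-- Multiplication of the `α`-bicyclic monoid: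
`(a,b) * (c,d) = (a + (c - b), d)` if `b ≤ c`, and `(a, d + (b - c))` if `c < b`,
where `x - y` is the unique ordinal `z` with `y + z = x` (for `y ≤ x`). -/
noncomputable instance (α : Ordinal) : Mul (Balpha α) :=
  ⟨fun x y =>
    if _ : x.1.2 ≤ y.1.1 then
      ⟨(x.1.1 + (y.1.1 - x.1.2), y.1.2),
        principal_add_omega0_opow α x.2.1
          (lt_of_le_of_lt (Ordinal.sub_le_self _ _) y.2.1), y.2.2⟩
    else
      ⟨(x.1.1, y.1.2 + (x.1.2 - y.1.1)), x.2.1,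
        principal_add_omega0_opow α y.2.2
          (lt_of_le_of_lt (Ordinal.sub_le_self _ _) x.2.2)⟩⟩

/-- A convenient constructor for elements of `B_α`. -/
def Balpha.mk (α : Ordinal) (a b : Ordinal) (ha : a < omega0 ^ α) (hb : b < omega0 ^ α) :
    Balpha α := ⟨(a, b), ha, hb⟩

namespace Balpha

variable {α : Ordinal}

lemma mul_of_le {x y : Balpha α} (h : x.1.2 ≤ y.1.1) :
    (x * y).1 = (x.1.1 + (y.1.1 - x.1.2), y.1.2) :=
  congrArg Subtype.val (dif_pos h)

lemma mul_of_lt {x y : Balpha α} (h : y.1.1 < x.1.2) :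
    (x * y).1 = (x.1.1, y.1.2 + (x.1.2 - y.1.1)) :=
  congrArg Subtype.val (dif_neg h.not_ge)

lemma idem_mul_eq_iff {γ : Ordinal} (hγ : γ < omega0 ^ α) (x : Balpha α) :
    mk α γ γ hγ hγ * x = x ↔ γ ≤ x.1.1 := by
  constructor
  · intro h
    by_contra! hlt
    have h' := congrArg Prod.fst ((mul_of_lt (x := mk α γ γ hγ hγ) hlt).symm.trans
      (congrArg Subtype.val h))
    exact hlt.ne' h'
  · intro h
    refine Subtype.ext ((mul_of_le (x := mk α γ γ hγ hγ) h).trans (Prod.ext ?_ rfl))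
    exact Ordinal.add_sub_cancel_of_le h

lemma mul_idem_eq_iff {γ : Ordinal} (hγ : γ < omega0 ^ α) (x : Balpha α) :
    x * mk α γ γ hγ hγ = x ↔ γ ≤ x.1.2 := by
  constructor
  · intro h
    by_contra! hlt
    have h' := congrArg Prod.snd ((mul_of_le (y := mk α γ γ hγ hγ) hlt.le).symm.trans
      (congrArg Subtype.val h))
    exact hlt.ne' h'
  · intro h
    refine Subtype.ext ?_
    rcases h.eq_or_lt with h | h
    · refine (mul_of_le (y := mk α γ γ hγ hγ) h.ge).trans (Prod.ext ?_ h)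
      change x.1.1 + (γ - x.1.2) = x.1.1
      rw [← h, Ordinal.sub_self, add_zero]
    · refine (mul_of_lt (y := mk α γ γ hγ hγ) h).trans (Prod.ext rfl ?_)
      exact Ordinal.add_sub_cancel_of_le h.le

variable [TopologicalSpace (Balpha α)] [T2Space (Balpha α)]

lemma isOpen_fst_lt (hl : ∀ s : Balpha α, Continuous fun x => s * x)
    {γ : Ordinal} (hγ : γ < omega0 ^ α) : IsOpen {x : Balpha α | x.1.1 < γ} := by
  have h := (isClosed_eq (hl (mk α γ γ hγ hγ)) continuous_id).isOpen_compl
  convert h using 1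
  ext x
  simpa using (idem_mul_eq_iff hγ x).not.symm

lemma isOpen_snd_lt (hr : ∀ s : Balpha α, Continuous fun x => x * s)
    {γ : Ordinal} (hγ : γ < omega0 ^ α) : IsOpen {x : Balpha α | x.1.2 < γ} := by
  have h := (isClosed_eq (hr (mk α γ γ hγ hγ)) continuous_id).isOpen_compl
  convert h using 1
  ext x
  simpa using (mul_idem_eq_iff hγ x).not.symm

end Balpha

lemma Ordinal.omega0_opow_sub_of_lt {b d : Ordinal} (h : d < omega0 ^ b) :
    omega0 ^ b - d = omega0 ^ b := by
  refine (Ordinal.sub_le_self _ _).eq_of_not_lt fun hlt => ?_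
  have h' := isPrincipal_add_omega0_opow b h hlt
  change d + (omega0 ^ b - d) < omega0 ^ b at h'
  rw [Ordinal.add_sub_cancel_of_le h.le] at h'
  exact h'.false

/-- For a semitopological `α`-bicyclic monoid `(B_α, τ)` (Hausdorff, separately
continuous multiplication), for every pair of distinct ordinals `a, b < α` the element
`(ω ^ a, ω ^ b)` is an isolated point. -/
theorem isolated_opow_pairs (α : Ordinal) [TopologicalSpace (Balpha α)] [T2Space (Balpha α)]
    (hl : ∀ s : Balpha α, Continuous fun x => s * x)
    (hr : ∀ s : Balpha α, Continuous fun x => x * s)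
    (a b : Ordinal) (ha : a < α) (hb : b < α) (hab : a ≠ b) :
    IsOpen {Balpha.mk α (omega0 ^ a) (omega0 ^ b)
      ((opow_lt_opow_iff_right one_lt_omega0).2 ha)
      ((opow_lt_opow_iff_right one_lt_omega0).2 hb)} := by
  have hα : α ≠ 0 := (bot_le.trans_lt ha).ne'
  have hA : omega0 ^ a < omega0 ^ α := (opow_lt_opow_iff_right one_lt_omega0).2 ha
  have hB : omega0 ^ b < omega0 ^ α := (opow_lt_opow_iff_right one_lt_omega0).2 hb
  have h0 : 0 < omega0 ^ α := opow_pos _ omega0_pos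
  have hlim : Order.IsSuccLimit (omega0 ^ α) := isSuccLimit_opow_left isSuccLimit_omega0 hα
  have hA' := hlim.succ_lt hA
  have hB' := hlim.succ_lt hB
  have hV := (((Balpha.isOpen_fst_lt hl hA').inter (Balpha.isOpen_snd_lt hr hB')).inter
    ((Balpha.isOpen_fst_lt hl hA').preimage (hr (Balpha.mk α _ 0 hB h0)))).inter
    ((Balpha.isOpen_snd_lt hr hB').preimage (hl (Balpha.mk α 0 _ h0 hA)))
  convert hV using 1
  ext x
  simp only [Set.mem_singleton_iff, Set.mem_inter_iff, Set.mem_preimage, Set.mem_ofPred_eq,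
    Order.lt_succ_iff]
  constructor
  · rintro rfl
    refine ⟨⟨⟨le_rfl, le_rfl⟩, ?_⟩, ?_⟩
    · rw [Balpha.mul_of_le le_rfl]
      simp [Balpha.mk]
    · rw [Balpha.mul_of_le le_rfl]
      simp [Balpha.mk]
  · rintro ⟨⟨⟨hca, hdb⟩, h1⟩, h2⟩
    rw [Balpha.mul_of_le (x := x) (y := Balpha.mk α _ 0 hB h0) hdb] at h1
    change x.1.1 + (omega0 ^ b - x.1.2) ≤ omega0 ^ a at h1
    have hsnd : x.1.1 < omega0 ^ a → x.1.2 + omega0 ^ a ≤ omega0 ^ b := by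
      intro h
      rw [Balpha.mul_of_lt (x := Balpha.mk α 0 _ h0 hA) (y := x) h] at h2
      change x.1.2 + (omega0 ^ a - x.1.1) ≤ omega0 ^ b at h2
      rwa [omega0_opow_sub_of_lt h] at h2
    have habsurd : ∀ e f : Ordinal, ¬ omega0 ^ e + omega0 ^ f ≤ omega0 ^ e := fun e f h =>
      ((lt_add_iff_pos_right _).2 (opow_pos f omega0_pos)).not_ge h
    have hdeq : x.1.2 = omega0 ^ b := by
      refine hdb.eq_of_not_lt fun h => ?_
      rw [omega0_opow_sub_of_lt h] at h1
      rcases hca.eq_or_lt with heq | hlt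
      · exact habsurd a b (heq ▸ h1)
      · have hba : omega0 ^ b ≤ omega0 ^ a := le_add_self.trans h1
        have hab' : omega0 ^ a ≤ omega0 ^ b := le_add_self.trans (hsnd hlt)
        exact hab ((opow_right_inj one_lt_omega0).1 (hab'.antisymm hba))
    have hceq : x.1.1 = omega0 ^ a :=
      hca.eq_of_not_lt fun h => habsurd b a (hdeq ▸ hsnd h)
    exact Subtype.ext (Prod.ext hceq hdeq)
end

section
/- Let α be an ordinal and let τ be a Hausdorff topology on the α-bicyclic monoid B_α for which multiplication is separately continuous. If every idempotent of B_α of the form (ω^a, ω^a) with a < α is an isolated point of (B_α, τ), then τ is the discrete topology on B_α. -/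
open Ordinal

/-- Every nonzero ordinal ends in a power of `ω`. -/
theorem exists_eq_add_omega0_opow {z : Ordinal} (hz : z ≠ 0) :
    ∃ u c : Ordinal, z = u + omega0 ^ c := by
  have hne : {w : Ordinal | w ≠ 0 ∧ ∃ u, u + w = z}.Nonempty := ⟨z, hz, 0, zero_add z⟩
  obtain ⟨hw, u, hu⟩ := WellFounded.min_mem Ordinal.lt_wf _ hne
  set w := WellFounded.min Ordinal.lt_wf _ hne
  have hp : IsPrincipal (· + ·) w := by
    rw [isPrincipal_add_iff_add_left_eq_self]
    intro p hpw
    have hsub : p + (w - p) = w := Ordinal.add_sub_cancel_of_le hpw.le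
    have hmem : w - p ∈ {w : Ordinal | w ≠ 0 ∧ ∃ u, u + w = z} :=
      ⟨fun h => hpw.not_ge (Ordinal.sub_eq_zero_iff_le.1 h), u + p, by rw [add_assoc, hsub, hu]⟩
    have hle : w ≤ w - p := not_lt.1 (WellFounded.not_lt_min Ordinal.lt_wf _ hmem)
    rwa [le_antisymm (Ordinal.sub_le_self w p) hle] at hsub
  obtain h | ⟨c, hc⟩ := isPrincipal_add_iff_zero_or_omega0_opow.1 hp
  · exact absurd h hw
  · exact ⟨u, c, by rw [← hu]; exact congrArg _ hc.symm⟩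

namespace Balpha

variable {α : Ordinal}

/-- The first coordinate of an element of `B_α`. -/
def fst (x : Balpha α) : Ordinal := x.1.1

/-- The second coordinate of an element of `B_α`. -/
def snd (x : Balpha α) : Ordinal := x.1.2

theorem fst_lt (x : Balpha α) : x.fst < omega0 ^ α := x.2.1

theorem snd_lt (x : Balpha α) : x.snd < omega0 ^ α := x.2.2

@[simp]
theorem fst_mk (a b : Ordinal) (ha hb) : (mk α a b ha hb).fst = a := rfl

@[simp]
theorem snd_mk (a b : Ordinal) (ha hb) : (mk α a b ha hb).snd = b := rfl

theorem ext_fst_snd {x y : Balpha α} (h₁ : x.fst = y.fst) (h₂ : x.snd = y.snd) : x = y :=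
  Subtype.ext (Prod.ext h₁ h₂)

theorem fst_mul_of_le {x y : Balpha α} (h : x.snd ≤ y.fst) :
    (x * y).fst = x.fst + (y.fst - x.snd) :=
  congrArg fst (dif_pos h)

theorem snd_mul_of_le {x y : Balpha α} (h : x.snd ≤ y.fst) : (x * y).snd = y.snd :=
  (congrArg snd (dif_pos h :) :)

theorem fst_mul_of_lt {x y : Balpha α} (h : y.fst < x.snd) : (x * y).fst = x.fst :=
  (congrArg fst (dif_neg h.not_ge :) :)

theorem snd_mul_of_lt {x y : Balpha α} (h : y.fst < x.snd) :
    (x * y).snd = y.snd + (x.snd - y.fst) :=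
  congrArg snd (dif_neg h.not_ge)

theorem mul_idempotent_eq_self {e x : Balpha α} (he : e.fst = e.snd) :
    x * e = x ↔ e.snd ≤ x.snd := by
  obtain h | h := le_or_gt x.snd e.fst
  · refine ⟨fun hx => by rw [← hx, snd_mul_of_le h], fun hx => ?_⟩
    have hxe : x.snd = e.fst := h.antisymm (he ▸ hx)
    apply ext_fst_snd
    · rw [fst_mul_of_le h, hxe, Ordinal.sub_self, add_zero]
    · rw [snd_mul_of_le h, hxe, he]
  · refine ⟨fun _ => he ▸ h.le, fun _ => ext_fst_snd (fst_mul_of_lt h) ?_⟩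
    rw [snd_mul_of_lt h, ← he, Ordinal.add_sub_cancel_of_le h.le]

theorem idempotent_mul_eq_self {e x : Balpha α} (he : e.fst = e.snd) :
    e * x = x ↔ e.fst ≤ x.fst := by
  obtain h | h := le_or_gt e.snd x.fst
  · refine ⟨fun _ => he ▸ h, fun _ => ext_fst_snd ?_ (snd_mul_of_le h)⟩
    rw [fst_mul_of_le h, he, Ordinal.add_sub_cancel_of_le h]
  · refine ⟨fun hx => by rw [← hx, fst_mul_of_lt h], fun hx => ?_⟩
    exact absurd (he ▸ hx) h.not_ge

/-- The identity `(0, 0)` of `B_α`. -/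
def unit (α : Ordinal) : Balpha α :=
  mk α 0 0 (opow_pos α omega0_pos) (opow_pos α omega0_pos)

@[simp]
theorem fst_unit : (unit α).fst = 0 := rfl

@[simp]
theorem snd_unit : (unit α).snd = 0 := rfl

/-- The product `(0, p.fst) * x * (p.snd, 0)`, which translates the coordinates of `x` down by
those of `p` whenever this is possible. -/
noncomputable def translate (p x : Balpha α) : Balpha α :=
  mk α 0 p.fst (opow_pos α omega0_pos) p.fst_lt * x * mk α p.snd 0 p.snd_lt (opow_pos α omega0_pos)

theorem fst_translate_of_le {p x : Balpha α} (h₁ : p.fst ≤ x.fst) (h₂ : p.snd ≤ x.snd) :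
    (translate p x).fst = x.fst - p.fst := by
  have hl : (mk α 0 p.fst (opow_pos α omega0_pos) p.fst_lt).snd ≤ x.fst := h₁
  obtain h | h := h₂.eq_or_lt
  · rw [translate, fst_mul_of_le (by simp [snd_mul_of_le hl, h]), fst_mul_of_le hl,
      snd_mul_of_le hl]
    simp [h]
  · rw [translate, fst_mul_of_lt (by simpa [snd_mul_of_le hl] using h), fst_mul_of_le hl]
    simp

theorem snd_translate_of_le {p x : Balpha α} (h₁ : p.fst ≤ x.fst) (h₂ : p.snd ≤ x.snd) :
    (translate p x).snd = x.snd - p.snd := by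
  have hl : (mk α 0 p.fst (opow_pos α omega0_pos) p.fst_lt).snd ≤ x.fst := h₁
  obtain h | h := h₂.eq_or_lt
  · rw [translate, snd_mul_of_le (by simp [snd_mul_of_le hl, h])]
    simp [h]
  · rw [translate, snd_mul_of_lt (by simpa [snd_mul_of_le hl] using h), snd_mul_of_le hl]
    simp

theorem le_fst_of_fst_translate_ne_zero {p x : Balpha α} (h₁ : (translate p x).fst ≠ 0)
    (h₂ : (translate p x).snd ≠ 0) : p.fst ≤ x.fst := by
  by_contra! h
  set l := mk α 0 p.fst (opow_pos α omega0_pos) p.fst_lt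
  set r := mk α p.snd 0 p.snd_lt (opow_pos α omega0_pos)
  have hlx : x.fst < l.snd := h
  obtain h' | h' := le_or_gt (l * x).snd r.fst
  · exact h₂ (snd_mul_of_le h')
  · exact h₁ ((fst_mul_of_lt h').trans (fst_mul_of_lt hlx))

theorem le_snd_of_snd_translate_ne_zero {p x : Balpha α} (h₁ : (translate p x).fst ≠ 0)
    (h₂ : (translate p x).snd ≠ 0) : p.snd ≤ x.snd := by
  have hle := le_fst_of_fst_translate_ne_zero h₁ h₂
  by_contra! h
  refine h₂ (snd_mul_of_le ?_)
  rw [snd_mul_of_le (by exact hle)]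
  exact h.le

theorem eq_or_exists_of_translate_eq_unit {p x : Balpha α} (h : translate p x = unit α) :
    x = p ∨ ∃ z ≠ 0, x.fst + z = p.fst ∧ x.snd + z = p.snd := by
  have h₁ : (translate p x).fst = 0 := by rw [h, fst_unit]
  have h₂ : (translate p x).snd = 0 := by rw [h, snd_unit]
  set l := mk α 0 p.fst (opow_pos α omega0_pos) p.fst_lt
  set r := mk α p.snd 0 p.snd_lt (opow_pos α omega0_pos)
  change (l * x * r).fst = 0 at h₁
  change (l * x * r).snd = 0 at h₂
  obtain hlx | hlx := le_or_gt l.snd x.fst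
  · left
    have hs : (l * x).snd = x.snd := snd_mul_of_le hlx
    have hf : (l * x).fst = x.fst - p.fst := (fst_mul_of_le hlx).trans (zero_add _)
    obtain hxr | hxr := le_or_gt (l * x).snd r.fst
    · rw [fst_mul_of_le hxr, hf, hs, Ordinal.add_eq_zero_iff, Ordinal.sub_eq_zero_iff_le,
        Ordinal.sub_eq_zero_iff_le] at h₁
      exact ext_fst_snd (h₁.1.antisymm hlx) ((hs ▸ hxr).antisymm h₁.2)
    · rw [snd_mul_of_lt hxr, Ordinal.add_eq_zero_iff, Ordinal.sub_eq_zero_iff_le] at h₂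
      exact absurd h₂.2 hxr.not_ge
  · right
    have hs : (l * x).snd = x.snd + (p.fst - x.fst) := snd_mul_of_lt hlx
    refine ⟨p.fst - x.fst, fun h0 => hlx.not_ge (Ordinal.sub_eq_zero_iff_le.1 h0),
      Ordinal.add_sub_cancel_of_le hlx.le, ?_⟩
    rw [← hs]
    obtain hxr | hxr := le_or_gt (l * x).snd r.fst
    · rw [fst_mul_of_le hxr, Ordinal.add_eq_zero_iff, Ordinal.sub_eq_zero_iff_le] at h₁
      exact hxr.antisymm h₁.2
    · rw [snd_mul_of_lt hxr, Ordinal.add_eq_zero_iff, Ordinal.sub_eq_zero_iff_le] at h₂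
      exact absurd h₂.2 hxr.not_ge

section Topology

variable [TopologicalSpace (Balpha α)]

theorem isOpen_singleton_unit [T2Space (Balpha α)]
    (hl : ∀ s : Balpha α, Continuous fun x => s * x)
    (hr : ∀ s : Balpha α, Continuous fun x => x * s) : IsOpen {unit α} := by
  obtain rfl | hα := eq_zero_or_pos α
  · convert isOpen_univ
    refine Set.eq_univ_of_forall fun x => ext_fst_snd ?_ ?_
    · simpa using x.fst_lt
    · simpa using x.snd_lt
  have h1 : (1 : Ordinal) < omega0 ^ α := by
    simpa using (opow_lt_opow_iff_right one_lt_omega0).2 hα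
  let e := mk α 1 1 h1 h1
  have hcl : IsClosed ({x : Balpha α | x * e = x} ∪ {x | e * x = x}) :=
    (isClosed_eq (hr e) continuous_id).union (isClosed_eq (hl e) continuous_id)
  convert hcl.isOpen_compl using 1
  ext x
  have hr' : x * e = x ↔ 1 ≤ x.snd := mul_idempotent_eq_self rfl
  have hl' : e * x = x ↔ 1 ≤ x.fst := idempotent_mul_eq_self rfl
  simp only [Set.mem_singleton_iff, Set.mem_compl_iff, Set.mem_union, Set.mem_ofPred_eq, hr', hl',
    Order.one_le_iff_pos, not_or, not_lt, nonpos_iff_eq_zero]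
  exact ⟨fun h => h ▸ ⟨rfl, rfl⟩, fun h => ext_fst_snd h.2 h.1⟩

theorem continuous_translate (hl : ∀ s : Balpha α, Continuous fun x => s * x)
    (hr : ∀ s : Balpha α, Continuous fun x => x * s) (p : Balpha α) :
    Continuous (translate p) :=
  (hr _).comp (hl _)

end Topology

end Balpha

/-- For a semitopological `α`-bicyclic monoid `(B_α, τ)` (Hausdorff, separately
continuous multiplication), if every idempotent of the form `(ω ^ a, ω ^ a)` with
`a < α` is an isolated point, then `τ` is the discrete topology. -/
theorem discrete_of_isolated_idempotents (α : Ordinal) [TopologicalSpace (Balpha α)]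
    [T2Space (Balpha α)]
    (hl : ∀ s : Balpha α, Continuous fun x => s * x)
    (hr : ∀ s : Balpha α, Continuous fun x => x * s)
    (hidem : ∀ (a : Ordinal) (ha : a < α),
      IsOpen {Balpha.mk α (omega0 ^ a) (omega0 ^ a)
        ((opow_lt_opow_iff_right one_lt_omega0).2 ha)
        ((opow_lt_opow_iff_right one_lt_omega0).2 ha)}) :
    DiscreteTopology (Balpha α) := by
  refine discreteTopology_iff_isOpen_singleton.2 fun p => ?_
  by_cases H : ∃ x : Balpha α, ∃ z ≠ 0, x.fst + z = p.fst ∧ x.snd + z = p.snd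
  · obtain ⟨x, z, hz, h₁, h₂⟩ := H
    obtain ⟨u, c, rfl⟩ := exists_eq_add_omega0_opow hz
    rw [← add_assoc] at h₁ h₂
    have hc : c < α :=
      (opow_lt_opow_iff_right one_lt_omega0).1 ((h₁ ▸ le_add_self).trans_lt p.fst_lt)
    let q := Balpha.mk α (x.fst + u) (x.snd + u) ((h₁ ▸ le_self_add).trans_lt p.fst_lt)
      ((h₂ ▸ le_self_add).trans_lt p.snd_lt)
    have hq₁ : q.fst + omega0 ^ c = p.fst := h₁
    have hq₂ : q.snd + omega0 ^ c = p.snd := h₂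
    convert (hidem c hc).preimage (Balpha.continuous_translate hl hr q) using 1
    ext y
    simp only [Set.mem_singleton_iff, Set.mem_preimage]
    constructor
    · rintro rfl
      have hle₁ : q.fst ≤ y.fst := hq₁ ▸ le_self_add
      have hle₂ : q.snd ≤ y.snd := hq₂ ▸ le_self_add
      apply Balpha.ext_fst_snd
      · rw [Balpha.fst_translate_of_le hle₁ hle₂, ← hq₁, Ordinal.add_sub_cancel, Balpha.fst_mk]
      · rw [Balpha.snd_translate_of_le hle₁ hle₂, ← hq₂, Ordinal.add_sub_cancel, Balpha.snd_mk]
    · intro hy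
      have hy₁ : (q.translate y).fst = omega0 ^ c := by rw [hy, Balpha.fst_mk]
      have hy₂ : (q.translate y).snd = omega0 ^ c := by rw [hy, Balpha.snd_mk]
      have hc0 : omega0 ^ c ≠ 0 := (opow_pos c omega0_pos).ne'
      have hle₁ := Balpha.le_fst_of_fst_translate_ne_zero (hy₁ ▸ hc0) (hy₂ ▸ hc0)
      have hle₂ := Balpha.le_snd_of_snd_translate_ne_zero (hy₁ ▸ hc0) (hy₂ ▸ hc0)
      apply Balpha.ext_fst_snd
      · rw [← hq₁, ← hy₁, Balpha.fst_translate_of_le hle₁ hle₂, Ordinal.add_sub_cancel_of_le hle₁]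
      · rw [← hq₂, ← hy₂, Balpha.snd_translate_of_le hle₁ hle₂, Ordinal.add_sub_cancel_of_le hle₂]
  · convert (Balpha.isOpen_singleton_unit hl hr).preimage (Balpha.continuous_translate hl hr p)
      using 1
    ext y
    simp only [Set.mem_singleton_iff, Set.mem_preimage]
    constructor
    · rintro rfl
      apply Balpha.ext_fst_snd
      · rw [Balpha.fst_translate_of_le le_rfl le_rfl, Ordinal.sub_self, Balpha.fst_unit]
      · rw [Balpha.snd_translate_of_le le_rfl le_rfl, Ordinal.sub_self, Balpha.snd_unit]
    · exact fun hy => (Balpha.eq_or_exists_of_translate_eq_unit hy).resolve_right fun h => H ⟨y, h⟩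
end
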